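/- Let C be a ring equipped with a ℤ-grading, i.e., an internal direct sum decomposition C = ⊕_{n∈ℤ} C_n of additive subgroups with C_m·C_n ⊆ C_{m+n} and 1 ∈ C₀. Suppose there are elements t₊ ∈ C₁ and t₋ ∈ C₋₁ with t₋·t₊ = 1. Then: (a) the element e := t₊·t₋ lies in C₀ and is idempotent (e² = e); (b) the map φ : C₀ → C₀ defined by a ↦ t₊·a·t₋ is additive, multiplicative (φ(ab) = φ(a)φ(b)), injective, sends 1 to e, and its image is exactly the corner e·C₀·e = {x ∈ C₀ : e·x = x and x·e = x}. Consequently φ is an isomorphism from C₀ onto the corner ring e·C₀·e (a ring with identity element e). -/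

import Mathlib

/-- Let `C` be a `ℤ`-graded ring and `t₊ ∈ C₁`, `t₋ ∈ C₋₁` elements with `t₋·t₊ = 1`.  Then
(a) `e := t₊·t₋` lies in `C₀` and is idempotent; (b) the map `φ : C₀ → C₀`, `a ↦ t₊·a·t₋`,
is well defined (lands in `C₀`), additive, multiplicative, injective, sends `1` to `e`, and
its image is exactly the corner `e·C₀·e = {x ∈ C₀ | e·x = x ∧ x·e = x}`; consequently `φ` is
an isomorphism from `C₀` onto the corner ring `e·C₀·e`. -/
theorem corner_skew_laurent_characterization
    {C : Type*} [Ring C] (𝒜 : ℤ → AddSubgroup C) [GradedRing 𝒜]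
    (tp tm : C) (htp : tp ∈ 𝒜 1) (htm : tm ∈ 𝒜 (-1)) (h : tm * tp = 1) :
    (tp * tm ∈ 𝒜 0 ∧ (tp * tm) * (tp * tm) = tp * tm) ∧
    (∀ a ∈ 𝒜 0, tp * a * tm ∈ 𝒜 0) ∧
    (∀ a b : C, tp * (a + b) * tm = tp * a * tm + tp * b * tm) ∧
    (∀ a b : C, tp * (a * b) * tm = (tp * a * tm) * (tp * b * tm)) ∧
    (∀ a b : C, tp * a * tm = tp * b * tm → a = b) ∧
    (tp * 1 * tm = tp * tm) ∧
    (∀ x ∈ 𝒜 0,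
      (((tp * tm) * x = x ∧ x * (tp * tm) = x) ↔ ∃ a ∈ 𝒜 0, tp * a * tm = x)) := by
  have cancel (x : C) : tm * (tp * x) = x := by rw [← mul_assoc, h, one_mul]
  have recover (a : C) : tm * (tp * a * tm) * tp = a := by
    simp only [mul_assoc, h, cancel, mul_one]
  have deg_zero {a : C} (ha : a ∈ 𝒜 0) : tp * a * tm ∈ 𝒜 0 := by
    simpa using SetLike.mul_mem_graded (SetLike.mul_mem_graded htp ha) htm
  refine ⟨⟨by simpa using SetLike.mul_mem_graded htp htm, ?_⟩, fun _ => deg_zero, ?_, ?_, ?_, ?_,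
    fun x hx => ⟨?_, ?_⟩⟩
  · simp only [mul_assoc, cancel]
  · intro a b
    rw [mul_add, add_mul]
  · intro a b
    simp only [mul_assoc, cancel]
  · intro a b hab
    rw [← recover a, hab, recover]
  · rw [mul_one]
  · rintro ⟨hl, hr⟩
    refine ⟨tm * x * tp, ?_, ?_⟩
    · simpa using SetLike.mul_mem_graded (SetLike.mul_mem_graded htm hx) htp
    · calc tp * (tm * x * tp) * tm = tp * tm * x * (tp * tm) := by simp only [mul_assoc]
        _ = x := by rw [hl, hr]
  · rintro ⟨a, -, rfl⟩
    constructor <;> simp only [mul_assoc, cancel]
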